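/- arXiv:1109.3259 — 8 statements merged into one kernel-verified Lean document; each statement's English description precedes it below -/
import Mathlib

section
/- Define functions on ℝ²: ξ_{11}(x,y) = (1−x)(1−y)(1−x−y), ξ_{22}(x,y) = x(1−y)(x−y), ξ_{33}(x,y) = xy(−1+x+y), ξ_{44}(x,y) = (1−x)y(y−x), ξ_{12}(x,y) = (1−x)x(1−y), ξ_{23}(x,y) = x(1−y)y, ξ_{34}(x,y) = (1−x)xy, ξ_{14}(x,y) = (1−x)(1−y)y. Let v_1 = (0,0), v_2 = (1,0), v_3 = (1,1), v_4 = (0,1) be the vertices of the unit square, with edge midpoints v_{12} = (1/2,0), v_{23} = (1,1/2), v_{34} = (1/2,1), v_{14} = (0,1/2). Then for all (x,y) ∈ ℝ²: (i) ξ_{11} + ξ_{22} + ξ_{33} + ξ_{44} + 2ξ_{12} + 2ξ_{23} + 2ξ_{34} + 2ξ_{14} = 1; (ii) ∑_{i=1}^4 ξ_{ii}·v_i + 2ξ_{12}·v_{12} + 2ξ_{23}·v_{23} + 2ξ_{34}·v_{34} + 2ξ_{14}·v_{14} = (x,y); (iii) for all r,s ∈ {1,2}: ∑_{i=1}^4 ξ_{ii}(v_i)_r(v_i)_s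 + ξ_{12}[(v_1)_r(v_2)_s+(v_2)_r(v_1)_s] + ξ_{23}[(v_2)_r(v_3)_s+(v_3)_r(v_2)_s] + ξ_{34}[(v_3)_r(v_4)_s+(v_4)_r(v_3)_s] + ξ_{14}[(v_1)_r(v_4)_s+(v_4)_r(v_1)_s] = x_r y_s where (x_1,x_2) := (x,y). -/
/-- The eight quadratic serendipity basis functions on the unit square satisfy
constant, linear, and quadratic precision (Qξ1–Qξ3). -/
theorem unit_square_serendipity_precision
    (x y : ℝ)
    (ξ11 ξ22 ξ33 ξ44 ξ12 ξ23 ξ34 ξ14 : ℝ)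
    (h11 : ξ11 = (1 - x) * (1 - y) * (1 - x - y))
    (h22 : ξ22 = x * (1 - y) * (x - y))
    (h33 : ξ33 = x * y * (-1 + x + y))
    (h44 : ξ44 = (1 - x) * y * (y - x))
    (h12 : ξ12 = (1 - x) * x * (1 - y))
    (h23 : ξ23 = x * (1 - y) * y)
    (h34 : ξ34 = (1 - x) * x * y)
    (h14 : ξ14 = (1 - x) * (1 - y) * y)
    (v1 v2 v3 v4 m12 m23 m34 m14 : Fin 2 → ℝ)
    (hv1 : v1 = ![0, 0]) (hv2 : v2 = ![1, 0]) (hv3 : v3 = ![1, 1]) (hv4 : v4 = ![0, 1])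
    (hm12 : m12 = ![1/2, 0]) (hm23 : m23 = ![1, 1/2])
    (hm34 : m34 = ![1/2, 1]) (hm14 : m14 = ![0, 1/2]) :
    -- (i) constant precision
    (ξ11 + ξ22 + ξ33 + ξ44 + 2 * ξ12 + 2 * ξ23 + 2 * ξ34 + 2 * ξ14 = 1) ∧
    -- (ii) linear precision
    (ξ11 • v1 + ξ22 • v2 + ξ33 • v3 + ξ44 • v4 +
      (2 * ξ12) • m12 + (2 * ξ23) • m23 + (2 * ξ34) • m34 + (2 * ξ14) • m14 =
      ![x, y]) ∧
    -- (iii) quadratic precision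
    (∀ r s : Fin 2,
      ξ11 * (v1 r * v1 s) + ξ22 * (v2 r * v2 s) + ξ33 * (v3 r * v3 s) +
        ξ44 * (v4 r * v4 s) +
        ξ12 * (v1 r * v2 s + v2 r * v1 s) + ξ23 * (v2 r * v3 s + v3 r * v2 s) +
        ξ34 * (v3 r * v4 s + v4 r * v3 s) + ξ14 * (v1 r * v4 s + v4 r * v1 s) =
        (![x, y] : Fin 2 → ℝ) r * (![x, y] : Fin 2 → ℝ) s) := by
  subst h11 h22 h33 h44 h12 h23 h34 h14 hv1 hv2 hv3 hv4 hm12 hm23 hm34 hm14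
  refine ⟨by ring, ?_, ?_⟩
  · ext i
    fin_cases i <;> simp <;> ring
  · intro r s
    fin_cases r <;> fin_cases s <;> simp <;> ring
end

section
/- With ξ_{11}(x,y) = (1−x)(1−y)(1−x−y), ξ_{22}(x,y) = x(1−y)(x−y), ξ_{33}(x,y) = xy(−1+x+y), ξ_{44}(x,y) = (1−x)y(y−x), ξ_{12}(x,y) = (1−x)x(1−y), ξ_{23}(x,y) = x(1−y)y, ξ_{34}(x,y) = (1−x)xy, ξ_{14}(x,y) = (1−x)(1−y)y, regarded as polynomials in two variables x, y over ℝ, the ℝ-linear span of {ξ_{11}, ξ_{22}, ξ_{33}, ξ_{44}, ξ_{12}, ξ_{23}, ξ_{34}, ξ_{14}} equals the ℝ-linear span of {1, x, y, x², xy, y², x²y, xy²}. -/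
open MvPolynomial

/-- The quadratic serendipity functions span the quadratic serendipity space in any commutative
algebra, for any two elements `x` and `y` in place of the coordinates. -/
theorem span_serendipity_eq {R A : Type*} [CommRing R] [CommRing A] [Algebra R A] (x y : A) :
    Submodule.span R
      ({(1 - x) * (1 - y) * (1 - x - y),
        x * (1 - y) * (x - y),
        x * y * (-1 + x + y),
        (1 - x) * y * (y - x),
        (1 - x) * x * (1 - y),
        x * (1 - y) * y,
        (1 - x) * x * y,
        (1 - x) * (1 - y) * y} : Set A) =
    Submodule.span R
      ({1, x, y, x ^ 2, x * y, y ^ 2, x ^ 2 * y, x * y ^ 2} : Set A) := by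
  apply le_antisymm <;> rw [Submodule.span_le]
  · have h := Submodule.subset_span (R := R)
      (s := ({1, x, y, x ^ 2, x * y, y ^ 2, x ^ 2 * y, x * y ^ 2} : Set A))
    simp only [Set.insert_subset_iff, Set.singleton_subset_iff, SetLike.mem_coe] at h ⊢
    obtain ⟨h1, hx, hy, hxx, hxy, hyy, hxxy, hxyy⟩ := h
    refine ⟨?_, ?_, ?_, ?_, ?_, ?_, ?_, ?_⟩
    · convert sub_mem (sub_mem (sub_mem (sub_mem
        (add_mem (add_mem (add_mem h1 hxx) (nsmul_mem hxy 3)) hyy)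
        (nsmul_mem hx 2)) (nsmul_mem hy 2)) hxxy) hxyy using 1
      ring
    · convert sub_mem (sub_mem (add_mem hxx hxyy) hxy) hxxy using 1
      ring
    · convert sub_mem (add_mem hxxy hxyy) hxy using 1
      ring
    · convert sub_mem (sub_mem (add_mem hyy hxxy) hxy) hxyy using 1
      ring
    · convert sub_mem (sub_mem (add_mem hx hxxy) hxx) hxy using 1
      ring
    · convert sub_mem hxy hxyy using 1
      ring
    · convert sub_mem hxy hxxy using 1
      ring
    · convert sub_mem (sub_mem (add_mem hy hxyy) hxy) hyy using 1
      ring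
  · have h := Submodule.subset_span (R := R)
      (s := ({(1 - x) * (1 - y) * (1 - x - y),
        x * (1 - y) * (x - y),
        x * y * (-1 + x + y),
        (1 - x) * y * (y - x),
        (1 - x) * x * (1 - y),
        x * (1 - y) * y,
        (1 - x) * x * y,
        (1 - x) * (1 - y) * y} : Set A))
    simp only [Set.insert_subset_iff, Set.singleton_subset_iff, SetLike.mem_coe] at h ⊢
    obtain ⟨h11, h22, h33, h44, h12, h23, h34, h14⟩ := h
    refine ⟨?_, ?_, ?_, ?_, ?_, ?_, ?_, ?_⟩
    · convert add_mem (add_mem (add_mem (add_mem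
        (add_mem (add_mem (add_mem h11 h22) h33) h44)
        (nsmul_mem h12 2)) (nsmul_mem h23 2)) (nsmul_mem h34 2)) (nsmul_mem h14 2) using 1
      ring
    · convert add_mem (add_mem (add_mem (add_mem h22 h33) h12) (nsmul_mem h23 2)) h34 using 1
      ring
    · convert add_mem (add_mem (add_mem (add_mem h33 h44) h23) (nsmul_mem h34 2)) h14 using 1
      ring
    · convert add_mem (add_mem h22 h33) (nsmul_mem h23 2) using 1
      ring
    · convert add_mem (add_mem h33 h23) h34 using 1
      ring
    · convert add_mem (add_mem h33 h44) (nsmul_mem h34 2) using 1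
      ring
    · convert add_mem h33 h23 using 1
      ring
    · convert add_mem h33 h34 using 1
      ring

/-- The span of the eight serendipity basis polynomials on the unit square is
the standard quadratic serendipity space span{1, x, y, x², xy, y², x²y, xy²}. -/
theorem unit_square_serendipity_span
    (X0 X1 : MvPolynomial (Fin 2) ℝ) (hX0 : X0 = X 0) (hX1 : X1 = X 1) :
    Submodule.span ℝ
      ({(1 - X0) * (1 - X1) * (1 - X0 - X1),
        X0 * (1 - X1) * (X0 - X1),
        X0 * X1 * (-1 + X0 + X1),
        (1 - X0) * X1 * (X1 - X0),
        (1 - X0) * X0 * (1 - X1),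
        X0 * (1 - X1) * X1,
        (1 - X0) * X0 * X1,
        (1 - X0) * (1 - X1) * X1} : Set (MvPolynomial (Fin 2) ℝ)) =
    Submodule.span ℝ
      ({1, X0, X1, X0 ^ 2, X0 * X1, X1 ^ 2, X0 ^ 2 * X1, X0 * X1 ^ 2} :
        Set (MvPolynomial (Fin 2) ℝ)) := by
  exact span_serendipity_eq X0 X1
end

section
/- Let θ ∈ (0, π/2) and σ ∈ (0, θ]. Define c_0 := [(−1+cos σ)·cot θ + (1+cos σ)·tan θ] / [(−1+cos σ)(cot θ + tan θ)], c_− := [cos σ − sin σ·tan θ − 1] / [2(tan θ + cot θ)·sin σ·(cos σ − 1)], and c_+ := [1 − cos σ − sin σ·tan θ] / [2(tan θ + cot θ)·sin σ·(cos σ − 1)]. Then the following four equations hold: (a) 2c_0 + 4c_− + 4c_+ = 2; (b) 2cos θ·c_0 + 2[cos θ + cos(θ−σ)]·c_− + 2[cos θ + cos(θ+σ)]·c_+ = 2cos θ; (c) 2cos²θ·c_0 + 4cos θ·cos(θ−σ)·c_− + 4cos θ·cos(θ+σ)·c_+ = 2cos²θ; (d) 2sin²θ·c_0 + 4sin θ·sin(θ−σ)·c_−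 + 4sin θ·sin(θ+σ)·c_+ = −2sin²θ. -/
open Real

/-- For a regular polygon, the explicit symmetric coefficients c₀, c₋, c₊
satisfy the four precision equations (Qc1–Qc3). -/
theorem regular_polygon_coefficients_satisfy_precision
    (θ σ : ℝ) (hθ1 : 0 < θ) (hθ2 : θ < π / 2) (hσ1 : 0 < σ) (hσ2 : σ ≤ θ)
    (c0 cm cp : ℝ)
    (hc0 : c0 = ((-1 + cos σ) * cot θ + (1 + cos σ) * tan θ) /
      ((-1 + cos σ) * (cot θ + tan θ)))
    (hcm : cm = (cos σ - sin σ * tan θ - 1) /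
      (2 * (tan θ + cot θ) * sin σ * (cos σ - 1)))
    (hcp : cp = (1 - cos σ - sin σ * tan θ) /
      (2 * (tan θ + cot θ) * sin σ * (cos σ - 1))) :
    (2 * c0 + 4 * cm + 4 * cp = 2) ∧
    (2 * cos θ * c0 + 2 * (cos θ + cos (θ - σ)) * cm +
      2 * (cos θ + cos (θ + σ)) * cp = 2 * cos θ) ∧
    (2 * cos θ ^ 2 * c0 + 4 * cos θ * cos (θ - σ) * cm +
      4 * cos θ * cos (θ + σ) * cp = 2 * cos θ ^ 2) ∧
    (2 * sin θ ^ 2 * c0 + 4 * sin θ * sin (θ - σ) * cm +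
      4 * sin θ * sin (θ + σ) * cp = -2 * sin θ ^ 2) := by
  have hS : sin θ ≠ 0 := (sin_pos_of_pos_of_lt_pi hθ1 (by linarith)).ne'
  have hC : cos θ ≠ 0 := (cos_pos_of_mem_Ioo ⟨by linarith, hθ2⟩).ne'
  have hs : sin σ ≠ 0 := (sin_pos_of_pos_of_lt_pi hσ1 (by linarith)).ne'
  have hk : cos σ - 1 ≠ 0 := by
    intro h
    apply hs
    have := sin_sq_add_cos_sq σ
    rw [show cos σ = 1 by linarith] at this
    exact pow_eq_zero_iff two_ne_zero |>.mp (by linarith)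
  have hsq := sin_sq_add_cos_sq θ
  have hsum : tan θ + cot θ = 1 / (sin θ * cos θ) := by
    rw [tan_eq_sin_div_cos, cot_eq_cos_div_sin]
    field_simp
    linarith
  have h0 : c0 = cos θ ^ 2 + (1 + cos σ) * sin θ ^ 2 / (cos σ - 1) := by
    rw [hc0, add_comm (cot θ), hsum, tan_eq_sin_div_cos, cot_eq_cos_div_sin,
      neg_add_eq_sub]
    field_simp
  have hm : cm = -(sin θ ^ 2 / (cos σ - 1)) / 2 + sin θ * cos θ / sin σ / 2 := by
    rw [hcm, hsum, tan_eq_sin_div_cos]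
    field_simp
    ring
  have hp : cp = -(sin θ ^ 2 / (cos σ - 1)) / 2 - sin θ * cos θ / sin σ / 2 := by
    rw [hcp, hsum, tan_eq_sin_div_cos]
    field_simp
    ring
  rw [h0, hm, hp, cos_sub, cos_add, sin_sub, sin_add]
  refine ⟨?_, ?_, ?_, ?_⟩ <;> field_simp <;> grind
end

section
/- Let ℓ > 0 and let v_1 = (−ℓ, 0), v_3 = (ℓ, 0), v_2 = (x_2, y_2) with y_2 < 0, and v_4 = (x_4, y_4) with y_4 > 0 be points in ℝ². Define c^{12} := y_4/(y_4 − y_2), c^{34} := y_2/(y_2 − y_4), c^{23} := c^{12}, c^{14} := c^{34}, d := (c^{12}·x_2 + c^{34}·x_4)/ℓ, c^{11} := d − 1, and c^{33} := −d − 1. Then: (i) c^{11} + c^{33} + 2(c^{12} + c^{23} + c^{34} + c^{14}) = 2; (ii) c^{11}·v_1 + c^{33}·v_3 + c^{12}·(v_1 + v_2) + c^{23}·(v_2 + v_3) + c^{34}·(v_3 + v_4) + c^{14}·(v_1 + v_4) = (0, 0) = v_1 + v_3; (iii) for all r, s ∈ {1,2}: c^{11}(v_1)_r(v_1)_s + c^{33}(v_3)_r(v_3)_s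 + c^{12}[(v_1)_r(v_2)_s + (v_2)_r(v_1)_s] + c^{23}[(v_2)_r(v_3)_s + (v_3)_r(v_2)_s] + c^{34}[(v_3)_r(v_4)_s + (v_4)_r(v_3)_s] + c^{14}[(v_1)_r(v_4)_s + (v_4)_r(v_1)_s] = (v_1)_r(v_3)_s + (v_3)_r(v_1)_s. -/
/-- The explicit '13'-column coefficients for a generic quadrilateral satisfy
the column constraints Qc1–Qc3. -/
theorem quadrilateral_column_constraints
    (ℓ x2 y2 x4 y4 : ℝ) (hℓ : 0 < ℓ) (hy2 : y2 < 0) (hy4 : 0 < y4)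
    (v1 v2 v3 v4 : Fin 2 → ℝ)
    (hv1 : v1 = ![-ℓ, 0]) (hv2 : v2 = ![x2, y2])
    (hv3 : v3 = ![ℓ, 0]) (hv4 : v4 = ![x4, y4])
    (c12 c34 c23 c14 d c11 c33 : ℝ)
    (hc12 : c12 = y4 / (y4 - y2)) (hc34 : c34 = y2 / (y2 - y4))
    (hc23 : c23 = c12) (hc14 : c14 = c34)
    (hd : d = (c12 * x2 + c34 * x4) / ℓ)
    (hc11 : c11 = d - 1) (hc33 : c33 = -d - 1) :
    -- (i) Qc1
    (c11 + c33 + 2 * (c12 + c23 + c34 + c14) = 2) ∧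
    -- (ii) Qc2
    (c11 • v1 + c33 • v3 + c12 • (v1 + v2) + c23 • (v2 + v3) +
        c34 • (v3 + v4) + c14 • (v1 + v4) = (0 : Fin 2 → ℝ) ∧
      v1 + v3 = (0 : Fin 2 → ℝ)) ∧
    -- (iii) Qc3
    (∀ r s : Fin 2,
      c11 * (v1 r * v1 s) + c33 * (v3 r * v3 s) +
        c12 * (v1 r * v2 s + v2 r * v1 s) + c23 * (v2 r * v3 s + v3 r * v2 s) +
        c34 * (v3 r * v4 s + v4 r * v3 s) + c14 * (v1 r * v4 s + v4 r * v1 s) =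
        v1 r * v3 s + v3 r * v1 s) := by
  have hne : y4 - y2 ≠ 0 := by linarith
  have hc34' : c34 = -y2 / (y4 - y2) := by
    rw [hc34, ← neg_sub y4 y2, div_neg, neg_div]
  have hsum : c12 + c34 = 1 := by
    rw [hc12, hc34']
    field_simp
    ring
  have hy : c12 * y2 + c34 * y4 = 0 := by
    rw [hc12, hc34']
    field_simp
    ring
  have hdℓ : d * ℓ = c12 * x2 + c34 * x4 := by
    rw [hd, div_mul_cancel₀ _ hℓ.ne']
  clear hc12 hc34 hc34' hd
  subst hv1 hv2 hv3 hv4 hc23 hc14 hc11 hc33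
  refine ⟨by linear_combination 4 * hsum, ⟨?_, ?_⟩, fun r s => ?_⟩
  · ext i
    fin_cases i
    · simp
      linear_combination -2 * hdℓ
    · simp
      linear_combination 2 * hy
  · ext i
    fin_cases i <;> simp
  · fin_cases r <;> fin_cases s <;> simp <;> ring
end

section
/- Let ℓ > 0 and let v_1 = (−ℓ, 0), v_3 = (ℓ, 0), v_2 = (x_2, y_2) with y_2 < 0, and v_4 = (x_4, y_4) with y_4 > 0 be points in ℝ², and assume additionally that the segment from v_2 to v_4 intersects the segment from v_1 to v_3 (as holds for the diagonals of any convex quadrilateral with vertices v_1, v_2, v_3, v_4 in counterclockwise order). Define c^{12} := y_4/(y_4 − y_2), c^{34} := y_2/(y_2 − y_4), c^{23} := c^{12}, c^{14} := c^{34}, d := (c^{12}·x_2 + c^{34}·x_4)/ℓ, c^{11} := d − 1, and c^{33} := −d − 1. Then c^{12}, c^{34}, c^{23}, c^{14} ∈ (0, 1), d ∈ [−1, 1], |c^{11}| ≤ 2, and |c^{33}| ≤ 2; in particular every coefficient has absolute value at most 2. -/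
/-- Uniform bound on the '13'-column coefficients of the serendipity reduction
matrix over all convex quadrilaterals. -/
theorem quadrilateral_coefficients_bounded
    (ℓ x2 y2 x4 y4 : ℝ) (hℓ : 0 < ℓ) (hy2 : y2 < 0) (hy4 : 0 < y4)
    (v1 v2 v3 v4 : Fin 2 → ℝ)
    (hv1 : v1 = ![-ℓ, 0]) (hv2 : v2 = ![x2, y2])
    (hv3 : v3 = ![ℓ, 0]) (hv4 : v4 = ![x4, y4])
    (hdiag : ∃ z : Fin 2 → ℝ, z ∈ segment ℝ v2 v4 ∧ z ∈ segment ℝ v1 v3)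
    (c12 c34 c23 c14 d c11 c33 : ℝ)
    (hc12 : c12 = y4 / (y4 - y2)) (hc34 : c34 = y2 / (y2 - y4))
    (hc23 : c23 = c12) (hc14 : c14 = c34)
    (hd : d = (c12 * x2 + c34 * x4) / ℓ)
    (hc11 : c11 = d - 1) (hc33 : c33 = -d - 1) :
    c12 ∈ Set.Ioo (0 : ℝ) 1 ∧ c34 ∈ Set.Ioo (0 : ℝ) 1 ∧
    c23 ∈ Set.Ioo (0 : ℝ) 1 ∧ c14 ∈ Set.Ioo (0 : ℝ) 1 ∧
    d ∈ Set.Icc (-1 : ℝ) 1 ∧ |c11| ≤ 2 ∧ |c33| ≤ 2 ∧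
    (|c12| ≤ 2 ∧ |c34| ≤ 2 ∧ |c23| ≤ 2 ∧ |c14| ≤ 2) := by
  subst hv1 hv2 hv3 hv4
  obtain ⟨z, ⟨a, b, -, -, hab, rfl⟩, p, q, hp, hq, hpq, hz⟩ := hdiag
  have hx : -(p * ℓ) + q * ℓ = a * x2 + b * x4 := by
    simpa using congrFun hz 0
  have hy : a * y2 + b * y4 = 0 := by
    simpa using (congrFun hz 1).symm
  have hpos : 0 < y4 - y2 := by linarith
  have hneg : y2 - y4 < 0 := by linarith
  have ha : c12 = a := by
    rw [hc12, div_eq_iff hpos.ne']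
    linear_combination hy - y4 * hab
  have hb : c34 = b := by
    rw [hc34, div_eq_iff hneg.ne]
    linear_combination hy - y2 * hab
  have h12 : 0 < c12 := hc12 ▸ div_pos hy4 hpos
  have h34 : 0 < c34 := hc34 ▸ div_pos_of_neg_of_neg hy2 hneg
  have hsum : c12 + c34 = 1 := by rw [ha, hb, hab]
  have hdpq : d = q - p := by
    rw [hd, div_eq_iff hℓ.ne', ha, hb]
    linear_combination -hx
  simp only [Set.mem_Ioo, Set.mem_Icc, abs_le]
  refine ⟨⟨?_, ?_⟩, ⟨?_, ?_⟩, ⟨?_, ?_⟩, ⟨?_, ?_⟩, ⟨?_, ?_⟩, ⟨?_, ?_⟩, ⟨?_, ?_⟩, ⟨?_, ?_⟩,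
    ⟨?_, ?_⟩, ⟨?_, ?_⟩, ?_, ?_⟩ <;> linarith
end

section
/- Let ℓ > 0, v_a = (−ℓ, 0), v_b = (ℓ, 0), and let p_1, p_2, q_1, q_2 ∈ ℝ² with (p_1)_y ≠ (p_2)_y and (q_1)_y ≠ (q_2)_y. Define d_a := [(p_1)_x(p_2)_y − (p_2)_x(p_1)_y] / [((p_1)_y − (p_2)_y)·ℓ] and d_b := [(q_2)_x(q_1)_y − (q_1)_x(q_2)_y] / [((q_1)_y − (q_2)_y)·ℓ], assume d_a + d_b ≠ 2, and set s := 2/(2 − (d_a + d_b)). Suppose real numbers c⁻_a, c⁺_a, c⁻_b, c⁺_b satisfy c⁻_a + c⁺_a = s, c⁻_a·p_1 + c⁺_a·p_2 = s·d_a·v_a (as vectors in ℝ²), c⁻_b + c⁺_b = s, and c⁻_b·q_1 + c⁺_b·q_2 = s·d_b·v_b, and define c^{aa} := (−2 − 2d_a)/(2 − (d_a + d_b)) and c^{bb} := (−2 − 2d_b)/(2 − (d_a + d_b)). Then: (i) c^{aa} + c^{bb} + 2(c⁻_a + c⁺_a + c⁻_b + c⁺_b) = 2; (ii) c^{aa}·v_a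 + c^{bb}·v_b + c⁻_a·(p_1 + v_a) + c⁺_a·(v_a + p_2) + c⁻_b·(q_1 + v_b) + c⁺_b·(v_b + q_2) = v_a + v_b = (0,0); (iii) for all r, t ∈ {1,2}: c^{aa}(v_a)_r(v_a)_t + c^{bb}(v_b)_r(v_b)_t + c⁻_a[(p_1)_r(v_a)_t + (v_a)_r(p_1)_t] + c⁺_a[(v_a)_r(p_2)_t + (p_2)_r(v_a)_t] + c⁻_b[(q_1)_r(v_b)_t + (v_b)_r(q_1)_t] + c⁺_b[(v_b)_r(q_2)_t + (q_2)_r(v_b)_t] = (v_a)_r(v_b)_t + (v_b)_r(v_a)_t. -/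
/-- The six nonzero coefficients of the ab-column of the serendipity reduction
matrix for a generic convex polygon satisfy the column constraints Qc1–Qc3. -/
theorem generic_polygon_column_constraints
    (ℓ : ℝ) (hℓ : 0 < ℓ)
    (va vb p1 p2 q1 q2 : Fin 2 → ℝ)
    (hva : va = ![-ℓ, 0]) (hvb : vb = ![ℓ, 0])
    (hp : p1 1 ≠ p2 1) (hq : q1 1 ≠ q2 1)
    (da db s : ℝ)
    (hda : da = (p1 0 * p2 1 - p2 0 * p1 1) / ((p1 1 - p2 1) * ℓ))
    (hdb : db = (q2 0 * q1 1 - q1 0 * q2 1) / ((q1 1 - q2 1) * ℓ))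
    (hsum : da + db ≠ 2)
    (hs : s = 2 / (2 - (da + db)))
    (cam cap cbm cbp caa cbb : ℝ)
    (hca1 : cam + cap = s)
    (hca2 : cam • p1 + cap • p2 = (s * da) • va)
    (hcb1 : cbm + cbp = s)
    (hcb2 : cbm • q1 + cbp • q2 = (s * db) • vb)
    (hcaa : caa = (-2 - 2 * da) / (2 - (da + db)))
    (hcbb : cbb = (-2 - 2 * db) / (2 - (da + db))) :
    -- (i) Qc1
    (caa + cbb + 2 * (cam + cap + cbm + cbp) = 2) ∧
    -- (ii) Qc2
    (caa • va + cbb • vb + cam • (p1 + va) + cap • (va + p2) +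
        cbm • (q1 + vb) + cbp • (vb + q2) = va + vb ∧
      va + vb = (0 : Fin 2 → ℝ)) ∧
    -- (iii) Qc3
    (∀ r t : Fin 2,
      caa * (va r * va t) + cbb * (vb r * vb t) +
        cam * (p1 r * va t + va r * p1 t) + cap * (va r * p2 t + p2 r * va t) +
        cbm * (q1 r * vb t + vb r * q1 t) + cbp * (vb r * q2 t + q2 r * vb t) =
        va r * vb t + vb r * va t) := by
  have hD : 2 - (da + db) ≠ 0 := sub_ne_zero.mpr hsum.symm
  have hsD : s * (2 - (da + db)) = 2 := by rw [hs]; field_simp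
  have haa : caa = -s - s * da := by rw [hcaa, hs]; field_simp
  have hbb : cbb = -s - s * db := by rw [hcbb, hs]; field_simp
  clear hcaa hcbb hs hda hdb
  have ha0 := congrFun hca2 0
  have ha1 := congrFun hca2 1
  have hb0 := congrFun hcb2 0
  have hb1 := congrFun hcb2 1
  subst hva hvb haa hbb
  simp at ha0 ha1 hb0 hb1
  refine ⟨by linear_combination 2 * hca1 + 2 * hcb1 + hsD, ⟨?_, ?_⟩, ?_⟩
  · ext i
    fin_cases i <;> simp [Matrix.vecHead, Matrix.vecTail]
    · linear_combination ha0 + hb0 - ℓ * hca1 + ℓ * hcb1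
    · linear_combination ha1 + hb1
  · ext i
    fin_cases i <;> simp
  · intro r t
    fin_cases r <;> fin_cases t <;> simp
    · linear_combination -2 * ℓ * ha0 + 2 * ℓ * hb0 - ℓ ^ 2 * hsD
    · linear_combination -ℓ * ha1 + ℓ * hb1
    · linear_combination -ℓ * ha1 + ℓ * hb1
end

section
/- Let ℓ > 0, d* > 0, 0 < β* < π, and v = (−ℓ, 0) ∈ ℝ². Let p, q ∈ ℝ² with p_y > 0 > q_y, dist(v, p) ≥ d*, dist(v, q) ≥ d*, and suppose the angle β := ∠ p v q satisfies β ≤ β*. Let x₀ := (p_x·q_y − q_x·p_y)/(q_y − p_y) be the first coordinate of the point where the line through p and q crosses the x-axis, and assume x₀ ≥ −ℓ. Then x₀ ≥ −ℓ + d*·sin((π − β*)/2). -/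
open Real EuclideanGeometry

/-- A convex combination of two vectors of length at least `d` has length at least `d` times the
cosine of half the angle between them. -/
theorem mul_cos_half_angle_le_norm_convexCombination
    {E : Type*} [NormedAddCommGroup E] [InnerProductSpace ℝ E]
    {x y : E} {d s t : ℝ} (hs : 0 ≤ s) (ht : 0 ≤ t) (hst : s + t = 1)
    (hx : d ≤ ‖x‖) (hy : d ≤ ‖y‖) :
    d * Real.cos (InnerProductGeometry.angle x y / 2) ≤ ‖s • x + t • y‖ := by
  set c := Real.cos (InnerProductGeometry.angle x y / 2) with hc
  have hc0 : 0 ≤ c := Real.cos_nonneg_of_mem_Icc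
    ⟨by linarith [InnerProductGeometry.angle_nonneg x y, Real.pi_pos],
      by linarith [InnerProductGeometry.angle_le_pi x y]⟩
  have hc1 : c ≤ 1 := Real.cos_le_one _
  have hcos : Real.cos (InnerProductGeometry.angle x y) = 2 * c ^ 2 - 1 := by
    rw [hc, ← Real.cos_two_mul]
    congr 1
    ring
  have hinner : inner ℝ x y = (2 * c ^ 2 - 1) * (‖x‖ * ‖y‖) := by
    rw [← hcos, InnerProductGeometry.cos_angle_mul_norm_mul_norm]
  have hd : d ≤ s * ‖x‖ + t * ‖y‖ := by
    calc d = s * d + t * d := by rw [← add_mul, hst, one_mul]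
      _ ≤ s * ‖x‖ + t * ‖y‖ := by gcongr
  have hsq : ((s * ‖x‖ + t * ‖y‖) * c) ^ 2 ≤ ‖s • x + t • y‖ ^ 2 := by
    rw [norm_add_sq_real, real_inner_smul_left, real_inner_smul_right, hinner, norm_smul,
      norm_smul, Real.norm_of_nonneg hs, Real.norm_of_nonneg ht]
    have hnonneg : 0 ≤ (s * ‖x‖ - t * ‖y‖) ^ 2 * (1 - c ^ 2) :=
      mul_nonneg (sq_nonneg _) (by nlinarith)
    linarith
  calc d * c ≤ (s * ‖x‖ + t * ‖y‖) * c := by gcongr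
    _ ≤ ‖s • x + t • y‖ := (le_abs_self _).trans (abs_le_of_sq_le_sq hsq (norm_nonneg _))

/-- Geometric margin: under minimum edge length and maximum angle conditions,
the x-intercept of the line through the two neighbors of the vertex (−ℓ,0) is
at least −ℓ + d*·sin((π − β*)/2). -/
theorem x_intercept_margin
    (ℓ dstar βstar : ℝ) (hℓ : 0 < ℓ) (hdstar : 0 < dstar)
    (hβ0 : 0 < βstar) (hβπ : βstar < π)
    (v p q : EuclideanSpace ℝ (Fin 2))
    (hv0 : v 0 = -ℓ) (hv1 : v 1 = 0)
    (hp : 0 < p 1) (hq : q 1 < 0)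
    (hvp : dstar ≤ dist v p) (hvq : dstar ≤ dist v q)
    (hangle : EuclideanGeometry.angle p v q ≤ βstar)
    (x0 : ℝ) (hx0 : x0 = (p 0 * q 1 - q 0 * p 1) / (q 1 - p 1))
    (hconv : -ℓ ≤ x0) :
    -ℓ + dstar * Real.sin ((π - βstar) / 2) ≤ x0 := by
  have hpos : 0 < p 1 - q 1 := by linarith
  set s := -q 1 / (p 1 - q 1) with hs
  set t := p 1 / (p 1 - q 1) with ht
  have hs0 : 0 ≤ s := div_nonneg (by linarith) hpos.le
  have ht0 : 0 ≤ t := div_nonneg hp.le hpos.le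
  have hst : s + t = 1 := by
    rw [hs, ht]
    field_simp
    ring
  have hmargin := mul_cos_half_angle_le_norm_convexCombination hs0 ht0 hst
    (x := p - v) (y := q - v) (d := dstar)
    (by rwa [← dist_eq_norm, dist_comm]) (by rwa [← dist_eq_norm, dist_comm])
  have hnorm : ‖s • (p - v) + t • (q - v)‖ = x0 + ℓ := by
    have hfst : s * (p 0 - v 0) + t * (q 0 - v 0) = x0 + ℓ := by
      have hne : q 1 - p 1 ≠ 0 := by linarith
      rw [hs, ht, hx0, hv0]
      field_simp
      ring
    have hsnd : s * (p 1 - v 1) + t * (q 1 - v 1) = 0 := by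
      rw [hs, ht, hv1]
      field_simp
      ring
    rw [EuclideanSpace.norm_eq, Fin.sum_univ_two]
    simp only [PiLp.add_apply, PiLp.smul_apply, PiLp.sub_apply, smul_eq_mul]
    rw [hfst, hsnd]
    simp [Real.sqrt_sq_eq_abs, abs_of_nonneg (show 0 ≤ x0 + ℓ by linarith)]
  have hcos : Real.sin ((π - βstar) / 2) ≤
      Real.cos (InnerProductGeometry.angle (p - v) (q - v) / 2) := by
    rw [sub_div, Real.sin_pi_div_two_sub]
    have hle : InnerProductGeometry.angle (p - v) (q - v) ≤ βstar := hangle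
    exact Real.cos_le_cos_of_nonneg_of_le_pi
      (by linarith [InnerProductGeometry.angle_nonneg (p - v) (q - v)])
      (by linarith) (by linarith)
  have hmul := mul_le_mul_of_nonneg_left hcos hdstar.le
  linarith
end

section
/- Fix n ≥ 3 and points v_1, …, v_n ∈ ℝ² (indices modulo n), a set Ω ⊆ ℝ² containing all vertices v_j and all edge midpoints m_j := (v_j + v_{j+1})/2, and functions λ_1, …, λ_n : Ω → ℝ satisfying λ_a(v_j) = δ_{aj} for all a, j, and λ_a(m_j) = 1/2 if a ∈ {j, j+1} and λ_a(m_j) = 0 otherwise. Let μ_{ab} := λ_a·λ_b for unordered pairs {a,b}, and let c^{ij}_{ab} ∈ ℝ (ij ranging over pairs {i,i} and {i,i+1}) satisfy the identity-block conditions c^{ii}_{aa} = δ_{ia}, c^{i(i+1)}_{aa} = 0, c^{ii}_{a(a+1)} = 0, c^{i(i+1)}_{a(a+1)} = δ_{ia} (the remaining coefficients c^{ij}_{ab} for nonadjacent distinct a, b are arbitrary). Define ξ_{ij} := ∑_{ab} c^{ij}_{ab} μ_{ab} (sum over all unordered pairs), ψ_{ii} := ξ_{ii} − ξ_{i(i+1)}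 − ξ_{(i−1)i}, and ψ_{i(i+1)} := 4·ξ_{i(i+1)}. Then for all i, j ∈ {1, …, n}: ψ_{ii}(v_j) = δ_{ij}, ψ_{ii}(m_j) = 0, ψ_{i(i+1)}(v_j) = 0, and ψ_{i(i+1)}(m_j) = δ_{ij}. -/
/-- A quadratic form, written as a diagonal part plus a strictly upper triangular part, evaluated
at a vector supported on two distinct indices. -/
theorem sum_diag_add_sum_Ioi_of_support_pair {ι R : Type*} [Fintype ι] [LinearOrder ι]
    [LocallyFiniteOrderTop ι] [CommRing R] (c : ι → ι → R) (hc : ∀ a b, c a b = c b a)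
    (l : ι → R) {j k : ι} (hjk : j ≠ k) (hl : ∀ a, a ≠ j → a ≠ k → l a = 0) :
    (∑ a, c a a * (l a * l a)) + (∑ a, ∑ b ∈ Finset.Ioi a, c a b * (l a * l b)) =
      c j j * (l j * l j) + c k k * (l k * l k) + c j k * (l j * l k) := by
  have key : ∀ f : ι → R, (∀ a, a ≠ j → a ≠ k → f a = 0) → ∑ a, f a = f j + f k := by
    intro f hf
    rw [← Finset.sum_pair hjk]
    symm
    refine Finset.sum_subset (Finset.subset_univ _) fun a _ ha => ?_
    simp only [Finset.mem_insert, Finset.mem_singleton, not_or] at ha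
    exact hf a ha.1 ha.2
  have inner : ∀ a, ∑ b ∈ Finset.Ioi a, c a b * (l a * l b) =
      (if a < j then c a j * (l a * l j) else 0) + if a < k then c a k * (l a * l k) else 0 := by
    intro a
    have : Finset.Ioi a = Finset.univ.filter (a < ·) := by ext; simp
    rw [this, Finset.sum_filter, key]
    intro b hbj hbk
    simp [hl b hbj hbk]
  rw [key _ fun a h₁ h₂ => by simp [hl a h₁ h₂]]
  simp only [inner]
  rw [key _ fun a h₁ h₂ => by simp [hl a h₁ h₂]]
  rcases hjk.lt_or_gt with h | h
  · simp [h, h.not_gt]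
  · simp [h, h.not_gt, hc k j, mul_comm (l k) (l j)]


/-- The transformed serendipity basis ψ is Lagrange-like: each ψ takes value 1
at its associated node (vertex or edge midpoint) and 0 at all other nodes. -/
theorem psi_basis_is_lagrange_like
    (n : ℕ) [NeZero n] (hn : 3 ≤ n)
    (v : Fin n → Fin 2 → ℝ) (Ω : Set (Fin 2 → ℝ))
    (m : Fin n → Fin 2 → ℝ) (hm : ∀ j, m j = (1 / 2 : ℝ) • (v j + v (j + 1)))
    (hvΩ : ∀ j, v j ∈ Ω) (hmΩ : ∀ j, m j ∈ Ω)
    (lam : Fin n → (Fin 2 → ℝ) → ℝ)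
    (hlamv : ∀ a j, lam a (v j) = if a = j then 1 else 0)
    (hlamm : ∀ a j, lam a (m j) = if a = j ∨ a = j + 1 then 1 / 2 else 0)
    (μ : Fin n → Fin n → (Fin 2 → ℝ) → ℝ)
    (hμ : ∀ a b x, μ a b x = lam a x * lam b x)
    (cV cE : Fin n → Fin n → Fin n → ℝ)
    (hcVsymm : ∀ i a b, cV i a b = cV i b a)
    (hcEsymm : ∀ i a b, cE i a b = cE i b a)
    -- identity-block conditions
    (hVV : ∀ i a : Fin n, cV i a a = if i = a then 1 else 0)
    (hEV : ∀ i a : Fin n, cE i a a = 0)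
    (hVE : ∀ i a : Fin n, cV i a (a + 1) = 0)
    (hEE : ∀ i a : Fin n, cE i a (a + 1) = if i = a then 1 else 0)
    (ξV ξE : Fin n → (Fin 2 → ℝ) → ℝ)
    (hξV : ∀ i x, ξV i x =
      (∑ a, cV i a a * μ a a x) + (∑ a, ∑ b ∈ Finset.Ioi a, cV i a b * μ a b x))
    (hξE : ∀ i x, ξE i x =
      (∑ a, cE i a a * μ a a x) + (∑ a, ∑ b ∈ Finset.Ioi a, cE i a b * μ a b x))
    (ψV ψE : Fin n → (Fin 2 → ℝ) → ℝ)
    (hψV : ∀ i x, ψV i x = ξV i x - ξE i x - ξE (i - 1) x)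
    (hψE : ∀ i x, ψE i x = 4 * ξE i x) :
    ∀ i j : Fin n,
      ψV i (v j) = (if i = j then 1 else 0) ∧
      ψV i (m j) = 0 ∧
      ψE i (v j) = 0 ∧
      ψE i (m j) = (if i = j then 1 else 0) := by
  have hne : ∀ j : Fin n, j ≠ j + 1 := by
    intro j h
    have h1 : (1 : Fin n) = 0 := by simpa using h.symm
    have := congrArg Fin.val h1
    rw [Fin.val_one', Fin.val_zero, Nat.mod_eq_of_lt (by omega)] at this
    omega
  have hval : ∀ (c : Fin n → Fin n → ℝ) (_ : ∀ a b, c a b = c b a) (j : Fin n) (x : Fin 2 → ℝ)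
      (_ : ∀ a, a ≠ j → a ≠ j + 1 → lam a x = 0),
      (∑ a, c a a * μ a a x) + (∑ a, ∑ b ∈ Finset.Ioi a, c a b * μ a b x) =
        c j j * (lam j x * lam j x) + c (j + 1) (j + 1) * (lam (j + 1) x * lam (j + 1) x) +
          c j (j + 1) * (lam j x * lam (j + 1) x) := by
    intro c hc j x hx
    simp only [hμ]
    exact sum_diag_add_sum_Ioi_of_support_pair c hc (fun a => lam a x) (hne j) hx
  have hv0 : ∀ j a, a ≠ j → a ≠ j + 1 → lam a (v j) = 0 := by
    intro j a h _
    simp [hlamv, h]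
  have hm0 : ∀ j a, a ≠ j → a ≠ j + 1 → lam a (m j) = 0 := by
    intro j a h h'
    simp [hlamm, h, h']
  have hVv : ∀ i j, ξV i (v j) = if i = j then 1 else 0 := by
    intro i j
    rw [hξV, hval _ (hcVsymm i) j _ (hv0 j), hVV, hVE]
    simp [hlamv, (hne j).symm]
  have hEv : ∀ i j, ξE i (v j) = 0 := by
    intro i j
    rw [hξE, hval _ (hcEsymm i) j _ (hv0 j), hEV, hEV]
    simp [hlamv, (hne j).symm]
  have hVm : ∀ i j, ξV i (m j) =
      (if i = j then 1 / 4 else 0) + if i = j + 1 then 1 / 4 else 0 := by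
    intro i j
    rw [hξV, hval _ (hcVsymm i) j _ (hm0 j), hVV, hVV, hVE]
    simp only [hlamm, true_or, or_true, if_true]
    split_ifs <;> norm_num
  have hEm : ∀ i j, ξE i (m j) = if i = j then 1 / 4 else 0 := by
    intro i j
    rw [hξE, hval _ (hcEsymm i) j _ (hm0 j), hEV, hEV, hEE]
    simp only [hlamm, true_or, or_true, if_true]
    split_ifs <;> norm_num
  intro i j
  refine ⟨?_, ?_, ?_, ?_⟩
  · simp [hψV, hVv, hEv]
  · simp only [hψV, hVm, hEm, sub_eq_iff_eq_add (a := i)]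
    ring
  · simp [hψE, hEv]
  · rw [hψE, hEm]
    split_ifs <;> norm_num
end
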